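/- arXiv:1310.2660 — 3 statements merged into one kernel-verified Lean document; each statement's English description precedes it below -/
import Mathlib

section
/- Fix capacities C1 > C2 > C* > 0, an upstream initial state (d1,s1) on capacity C1 with d1 > 0, and a downstream initial state (d2,s2) on capacity C2 with s2 > 0. If d1 ≤ min(s2, C*), then every feasible Riemann configuration has flux q = d1, and such a configuration exists. -/
/-- A traffic state on a road of capacity `C > 0` is a pair `(d,s)` of reals with
`0 ≤ d ≤ C`, `0 ≤ s ≤ C`, and `max d s = C`. -/
def IsTrafficState (C d s : ℝ) : Prop :=
  0 ≤ d ∧ d ≤ C ∧ 0 ≤ s ∧ s ≤ C ∧ max d s = C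

/-- A feasible Riemann configuration at a lane-drop bottleneck with upstream capacity `C1`,
downstream capacity `C2`, dropped capacity `Cstar`, upstream initial demand `d1`, and
downstream initial supply `s2`.  It consists of a flux `q ≥ 0`, upstream stationary and
interior states `(d1s,s1s)`, `(d1i,s1i)` (traffic states on capacity `C1`), and downstream
stationary and interior states `(d2s,s2s)`, `(d2i,s2i)` (traffic states on capacity `C2`),
subject to the wave-direction feasibility conditions and the capacity-drop entropy condition
on the interior states. -/
structure RiemannConfig (C1 C2 Cstar d1 s2 : ℝ) where
  q : ℝ
  d1s : ℝ
  s1s : ℝ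
  d1i : ℝ
  s1i : ℝ
  d2s : ℝ
  s2s : ℝ
  d2i : ℝ
  s2i : ℝ
  q_nonneg : 0 ≤ q
  up_stat : IsTrafficState C1 d1s s1s
  up_int : IsTrafficState C1 d1i s1i
  down_stat : IsTrafficState C2 d2s s2s
  down_int : IsTrafficState C2 d2i s2i
  /-- Either `q < d1` and the upstream stationary and interior states equal `(C1, q)`,
  or `q = d1`, the upstream stationary state is `(d1, C1)`, and `s1i > d1`. -/
  up_cond : (q < d1 ∧ d1s = C1 ∧ s1s = q ∧ d1i = C1 ∧ s1i = q) ∨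
            (q = d1 ∧ d1s = d1 ∧ s1s = C1 ∧ s1i > d1)
  /-- Either `q < s2` and the downstream stationary and interior states equal `(q, C2)`,
  or `q = s2`, the downstream stationary state is `(C2, s2)`, and `d2i > s2`. -/
  down_cond : (q < s2 ∧ d2s = q ∧ s2s = C2 ∧ d2i = q ∧ s2i = C2) ∨
              (q = s2 ∧ d2s = C2 ∧ s2s = s2 ∧ d2i > s2)
  /-- Entropy condition: `q = d1i` when `d1i ≤ s2i`. -/
  entropy_le : d1i ≤ s2i → q = d1i
  /-- Entropy condition: `q = min(s2i, Cstar)` when `d1i > s2i`. -/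
  entropy_gt : d1i > s2i → q = min s2i Cstar

/-- With capacities `C1 > C2 > Cstar > 0`, an upstream initial state
`(d1,s1)` on capacity `C1` with `d1 > 0`, and a downstream initial state `(d2,s2)` on
capacity `C2` with `s2 > 0`: if `d1 ≤ min(s2, Cstar)`, then every feasible Riemann
configuration has flux `q = d1`, and such a configuration exists. -/
theorem riemann_flux_case_one (C1 C2 Cstar d1 s1 d2 s2 : ℝ)
    (hC12 : C1 > C2) (hC2star : C2 > Cstar) (hCstar : Cstar > 0)
    (hup : IsTrafficState C1 d1 s1) (hd1 : d1 > 0)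
    (hdown : IsTrafficState C2 d2 s2) (hs2 : s2 > 0)
    (hcase : d1 ≤ min s2 Cstar) :
    (∀ cfg : RiemannConfig C1 C2 Cstar d1 s2, cfg.q = d1) ∧
    (∃ cfg : RiemannConfig C1 C2 Cstar d1 s2, cfg.q = d1) := by
  obtain ⟨hds, hdC⟩ := le_min_iff.mp hcase
  have hd1C2 : d1 < C2 := hdC.trans_lt hC2star
  have hd1C1 : d1 < C1 := hd1C2.trans hC12
  have free_state : ∀ {C : ℝ}, d1 < C → IsTrafficState C d1 C := fun h =>
    ⟨hd1.le, h.le, (hd1.trans h).le, le_rfl, max_eq_right h.le⟩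
  refine ⟨fun cfg => ?_, ?_⟩
  · rcases cfg.up_cond with ⟨hq, -, -, hd1i, -⟩ | ⟨hq, -⟩
    · rcases cfg.down_cond with ⟨-, -, -, -, hs2i⟩ | ⟨hq2, -⟩
      · have hflux := cfg.entropy_gt (by rw [hd1i, hs2i]; exact hC12)
        rw [hs2i, min_eq_right hC2star.le] at hflux
        linarith
      · linarith
    · exact hq
  · rcases hds.lt_or_eq with hlt | rfl
    · exact ⟨⟨d1, d1, C1, d1, C1, d1, C2, d1, C2, hd1.le, free_state hd1C1, free_state hd1C1,
        free_state hd1C2, free_state hd1C2, Or.inr ⟨rfl, rfl, rfl, hd1C1⟩,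
        Or.inl ⟨hlt, rfl, rfl, rfl, rfl⟩, fun _ => rfl, fun h => absurd h hd1C2.not_gt⟩, rfl⟩
    · have congested_state : IsTrafficState C2 C2 d1 :=
        ⟨(hd1.trans hd1C2).le, le_rfl, hd1.le, hd1C2.le, max_eq_left hd1C2.le⟩
      exact ⟨⟨d1, d1, C1, d1, C1, C2, d1, C2, d1, hd1.le, free_state hd1C1, free_state hd1C1,
        congested_state, congested_state, Or.inr ⟨rfl, rfl, rfl, hd1C1⟩,
        Or.inr ⟨rfl, rfl, rfl, hd1C2⟩, fun _ => rfl, fun h => absurd h (lt_irrefl _)⟩, rfl⟩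
end

section
/- Fix capacities C1 > C2 > C* > 0, an upstream initial state (d1,s1) on capacity C1 with d1 > 0, and a downstream initial state (d2,s2) on capacity C2 with s2 > 0. If d1 > s2 and s2 ≤ C*, then every feasible Riemann configuration has flux q = s2, and such a configuration exists. -/
/-- With capacities `C1 > C2 > Cstar > 0`, an upstream initial state
`(d1,s1)` on capacity `C1` with `d1 > 0`, and a downstream initial state `(d2,s2)` on
capacity `C2` with `s2 > 0`: if `d1 > s2` and `s2 ≤ Cstar`, then every feasible Riemann
configuration has flux `q = s2`, and such a configuration exists. -/
theorem riemann_flux_case_three (C1 C2 Cstar d1 s1 d2 s2 : ℝ)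
    (hC12 : C1 > C2) (hC2star : C2 > Cstar) (hCstar : Cstar > 0)
    (hup : IsTrafficState C1 d1 s1) (hd1 : d1 > 0)
    (hdown : IsTrafficState C2 d2 s2) (hs2 : s2 > 0)
    (hcase1 : d1 > s2) (hcase2 : s2 ≤ Cstar) :
    (∀ cfg : RiemannConfig C1 C2 Cstar d1 s2, cfg.q = s2) ∧
    (∃ cfg : RiemannConfig C1 C2 Cstar d1 s2, cfg.q = s2) := by
  obtain ⟨-, hd1C1, -, -, -⟩ := hup
  refine ⟨fun cfg => ?_, ?_⟩
  · rcases cfg.down_cond with ⟨hq, -, -, -, hs2i⟩ | ⟨hq, -⟩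
    · rcases cfg.up_cond with ⟨-, -, -, hd1i, -⟩ | ⟨hqd, -⟩
      · have h := cfg.entropy_gt (by rw [hd1i, hs2i]; exact hC12)
        rw [hs2i, min_eq_right hC2star.le] at h
        linarith
      · linarith
    · exact hq
  · have up : IsTrafficState C1 C1 s2 :=
      ⟨by linarith, le_rfl, hs2.le, by linarith, max_eq_left (by linarith)⟩
    have down : IsTrafficState C2 C2 s2 :=
      ⟨by linarith, le_rfl, hs2.le, by linarith, max_eq_left (by linarith)⟩
    exact ⟨{ q := s2, d1s := C1, s1s := s2, d1i := C1, s1i := s2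
             d2s := C2, s2s := s2, d2i := C2, s2i := s2
             q_nonneg := hs2.le
             up_stat := up
             up_int := up
             down_stat := down
             down_int := down
             up_cond := Or.inl ⟨hcase1, rfl, rfl, rfl, rfl⟩
             down_cond := Or.inr ⟨rfl, rfl, rfl, by linarith⟩
             entropy_le := fun h => by linarith
             entropy_gt := fun _ => (min_eq_left hcase2).symm }, rfl⟩
end

section
/- Fix capacities C1 > C2 > C* > 0, an upstream initial state (d1,s1) on capacity C1 with d1 > 0, and a downstream initial state (d2,s2) on capacity C2 with s2 > 0. If d1 > s2 > C*, then every feasible Riemann configuration has flux q = C*, such a configuration exists, and in it the upstream stationary state is (C1, C*) and the downstream stationary state is (C*, C2); in particular the flux C* is strictly smaller than the non-capacity-drop flux min(d1, s2) = s2. -/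
/-- When `d1 > s2 > Cstar`, the flux and both stationary states are determined. -/
theorem RiemannConfig.stationary_eq_of_capacity_drop {C1 C2 Cstar d1 s2 : ℝ}
    (hC12 : C1 > C2) (hC2star : C2 > Cstar) (hcase1 : d1 > s2) (hcase2 : s2 > Cstar)
    (cfg : RiemannConfig C1 C2 Cstar d1 s2) :
    cfg.q = Cstar ∧ cfg.d1s = C1 ∧ cfg.s1s = Cstar ∧ cfg.d2s = Cstar ∧ cfg.s2s = C2 := by
  obtain ⟨-, -, -, hs2i, -⟩ := cfg.down_int
  have hq_le : cfg.q ≤ s2 := by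
    rcases cfg.down_cond with h | h
    · exact h.1.le
    · exact h.1.le
  rcases cfg.up_cond with ⟨-, hd1s, hs1s, hd1i, -⟩ | ⟨hq, -⟩
  · have hq : cfg.q = min cfg.s2i Cstar := cfg.entropy_gt (by linarith)
    have hq_le_star : cfg.q ≤ Cstar := hq.trans_le (min_le_right _ _)
    rcases cfg.down_cond with ⟨-, hd2s, hs2s, -, hs2i_eq⟩ | ⟨hqs2, -⟩
    · rw [hs2i_eq, min_eq_right hC2star.le] at hq
      exact ⟨hq, hd1s, hs1s.trans hq, hd2s.trans hq, hs2s⟩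
    · linarith
  · linarith

/-- The configuration with flux `Cstar` whose stationary and interior states are `(C1, Cstar)`
upstream and `(Cstar, C2)` downstream. -/
def RiemannConfig.capacityDrop {C1 C2 Cstar d1 s2 : ℝ}
    (hC12 : C1 > C2) (hC2star : C2 > Cstar) (hCstar : Cstar > 0)
    (hcase1 : d1 > s2) (hcase2 : s2 > Cstar) : RiemannConfig C1 C2 Cstar d1 s2 :=
  have hup : IsTrafficState C1 C1 Cstar :=
    ⟨by linarith, le_rfl, hCstar.le, by linarith, max_eq_left (by linarith)⟩
  have hdown : IsTrafficState C2 Cstar C2 :=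
    ⟨hCstar.le, hC2star.le, by linarith, le_rfl, max_eq_right hC2star.le⟩
  { q := Cstar
    d1s := C1
    s1s := Cstar
    d1i := C1
    s1i := Cstar
    d2s := Cstar
    s2s := C2
    d2i := Cstar
    s2i := C2
    q_nonneg := hCstar.le
    up_stat := hup
    up_int := hup
    down_stat := hdown
    down_int := hdown
    up_cond := Or.inl ⟨hcase2.trans hcase1, rfl, rfl, rfl, rfl⟩
    down_cond := Or.inl ⟨hcase2, rfl, rfl, rfl, rfl⟩
    entropy_le := fun h => absurd h hC12.not_ge
    entropy_gt := fun _ => (min_eq_right hC2star.le).symm }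

/-- With capacities `C1 > C2 > Cstar > 0`, an upstream initial state
`(d1,s1)` on capacity `C1` with `d1 > 0`, and a downstream initial state `(d2,s2)` on
capacity `C2` with `s2 > 0`: if `d1 > s2 > Cstar`, then every feasible Riemann
configuration has flux `q = Cstar`, such a configuration exists, and in it the upstream
stationary state is `(C1, Cstar)` and the downstream stationary state is `(Cstar, C2)`;
in particular the flux `Cstar` is strictly smaller than the non-capacity-drop flux
`min(d1, s2) = s2`. -/
theorem riemann_flux_capacity_drop (C1 C2 Cstar d1 s1 d2 s2 : ℝ)
    (hC12 : C1 > C2) (hC2star : C2 > Cstar) (hCstar : Cstar > 0)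
    (hup : IsTrafficState C1 d1 s1) (hd1 : d1 > 0)
    (hdown : IsTrafficState C2 d2 s2) (hs2 : s2 > 0)
    (hcase1 : d1 > s2) (hcase2 : s2 > Cstar) :
    (∀ cfg : RiemannConfig C1 C2 Cstar d1 s2, cfg.q = Cstar) ∧
    (∃ cfg : RiemannConfig C1 C2 Cstar d1 s2, cfg.q = Cstar) ∧
    (∀ cfg : RiemannConfig C1 C2 Cstar d1 s2,
      cfg.d1s = C1 ∧ cfg.s1s = Cstar ∧ cfg.d2s = Cstar ∧ cfg.s2s = C2) ∧
    Cstar < min d1 s2 ∧ min d1 s2 = s2 := by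
  have key (cfg : RiemannConfig C1 C2 Cstar d1 s2) :=
    cfg.stationary_eq_of_capacity_drop hC12 hC2star hcase1 hcase2
  exact ⟨fun cfg => (key cfg).1,
    ⟨RiemannConfig.capacityDrop hC12 hC2star hCstar hcase1 hcase2, rfl⟩,
    fun cfg => (key cfg).2, lt_min (hcase2.trans hcase1) hcase2, min_eq_right hcase1.le⟩
end
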